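/- Fix i, j ∈ {1,2,3} with j ≠ i, and set β_j = 0 in the generalized Kepler–Coulomb Hamiltonian H^GKC_i. Then the four functions I₁₂, I₂₃, I₁₂₃, H^GKC_i together with either Lᵢ or L_j form a functionally independent family on D; that is, in each case there exists a point of D at which the five gradients (vectors in ℝ⁶) are linearly independent. -/

import Mathlib

namespace Paper
noncomputable section

/-- The κ-dependent cosine Cκ(x) = ∑ (−κ)^l x^{2l}/(2l)!. -/
def Ck (κ x : ℝ) : ℝ := ∑' l : ℕ, (-κ) ^ l * x ^ (2 * l) / (Nat.factorial (2 * l) : ℝ)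

/-- The κ-dependent sine Sκ(x) = ∑ (−κ)^l x^{2l+1}/(2l+1)!. -/
def Sk (κ x : ℝ) : ℝ := ∑' l : ℕ, (-κ) ^ l * x ^ (2 * l + 1) / (Nat.factorial (2 * l + 1) : ℝ)

/-- The κ-dependent tangent Tκ(x) = Sκ(x)/Cκ(x). -/
def Tk (κ x : ℝ) : ℝ := Sk κ x / Ck κ x

/-- Phase space ℝ³ × ℝ³ ≃ ℝ⁶ with canonical coordinates
`(r, θ, φ, p_r, p_θ, p_φ) = (x 0, x 1, x 2, x 3, x 4, x 5)`. -/
abbrev Pt := Fin 6 → ℝ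

/-- Partial derivative in the i-th coordinate direction. -/
def pd (f : Pt → ℝ) (i : Fin 6) (x : Pt) : ℝ := fderiv ℝ f x (Pi.single i 1)

/-- Canonical Poisson bracket {f,g} = ∑_{q} (∂f/∂q ∂g/∂p_q − ∂g/∂q ∂f/∂p_q). -/
def pb (f g : Pt → ℝ) (x : Pt) : ℝ :=
  ∑ i : Fin 3,
    (pd f ⟨i.1, by omega⟩ x * pd g ⟨i.1 + 3, by omega⟩ x
      - pd g ⟨i.1, by omega⟩ x * pd f ⟨i.1 + 3, by omega⟩ x)

/-- Gradient of a function on phase space, as a vector in ℝ⁶. -/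
def grad (f : Pt → ℝ) (x : Pt) : Fin 6 → ℝ := fun i => pd f i x

/-- The open domain D where Sκ₁(r), Cκ₁(r), Sκ₂(θ), Cκ₂(θ), cos φ, sin φ are nonzero. -/
def D (κ₁ κ₂ : ℝ) : Set Pt :=
  {x | Sk κ₁ (x 0) ≠ 0 ∧ Ck κ₁ (x 0) ≠ 0 ∧ Sk κ₂ (x 1) ≠ 0 ∧ Ck κ₂ (x 1) ≠ 0 ∧
       Real.cos (x 2) ≠ 0 ∧ Real.sin (x 2) ≠ 0}

/-- J₀₁ = Cκ₂(θ)p_r − (Sκ₂(θ)/Tκ₁(r))p_θ. -/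
def J01 (κ₁ κ₂ : ℝ) (x : Pt) : ℝ :=
  Ck κ₂ (x 1) * x 3 - (Sk κ₂ (x 1) / Tk κ₁ (x 0)) * x 4

/-- J₀₂. -/
def J02 (κ₁ κ₂ : ℝ) (x : Pt) : ℝ :=
  κ₂ * Sk κ₂ (x 1) * Real.cos (x 2) * x 3
    + (Ck κ₂ (x 1) * Real.cos (x 2) / Tk κ₁ (x 0)) * x 4
    - (Real.sin (x 2) / (Tk κ₁ (x 0) * Sk κ₂ (x 1))) * x 5

/-- J₀₃. -/
def J03 (κ₁ κ₂ : ℝ) (x : Pt) : ℝ :=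
  κ₂ * Sk κ₂ (x 1) * Real.sin (x 2) * x 3
    + (Ck κ₂ (x 1) * Real.sin (x 2) / Tk κ₁ (x 0)) * x 4
    + (Real.cos (x 2) / (Tk κ₁ (x 0) * Sk κ₂ (x 1))) * x 5

/-- J₁₂ = cos φ·p_θ − (sin φ/Tκ₂(θ))p_φ. -/
def J12 (κ₂ : ℝ) (x : Pt) : ℝ :=
  Real.cos (x 2) * x 4 - (Real.sin (x 2) / Tk κ₂ (x 1)) * x 5

/-- J₁₃ = sin φ·p_θ + (cos φ/Tκ₂(θ))p_φ. -/
def J13 (κ₂ : ℝ) (x : Pt) : ℝ :=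
  Real.sin (x 2) * x 4 + (Real.cos (x 2) / Tk κ₂ (x 1)) * x 5

/-- J₂₃ = p_φ. -/
def J23 (x : Pt) : ℝ := x 5

/-- Kinetic energy T. -/
def Tkin (κ₁ κ₂ : ℝ) (x : Pt) : ℝ :=
  (1 / 2) * ((x 3) ^ 2 + (x 4) ^ 2 / (κ₂ * Sk κ₁ (x 0) ^ 2)
    + (x 5) ^ 2 / (κ₂ * Sk κ₁ (x 0) ^ 2 * Sk κ₂ (x 1) ^ 2))

/-- The superintegrable potential U with arbitrary radial function F. -/
def U (κ₁ κ₂ : ℝ) (F : ℝ → ℝ) (β₁ β₂ β₃ : ℝ) (x : Pt) : ℝ :=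
  F (x 0) + (1 / Sk κ₁ (x 0) ^ 2) *
    (β₁ / Ck κ₂ (x 1) ^ 2 + β₂ / (Sk κ₂ (x 1) ^ 2 * Real.cos (x 2) ^ 2)
      + β₃ / (Sk κ₂ (x 1) ^ 2 * Real.sin (x 2) ^ 2))

/-- Integral I₁₂. -/
def I12 (κ₂ β₁ β₂ : ℝ) (x : Pt) : ℝ :=
  (Real.cos (x 2) * x 4 - (Real.sin (x 2) / Tk κ₂ (x 1)) * x 5) ^ 2
    + 2 * β₁ * κ₂ ^ 2 * Tk κ₂ (x 1) ^ 2 * Real.cos (x 2) ^ 2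
    + 2 * β₂ * κ₂ / (Tk κ₂ (x 1) ^ 2 * Real.cos (x 2) ^ 2)

/-- Integral I₁₃. -/
def I13 (κ₂ β₁ β₃ : ℝ) (x : Pt) : ℝ :=
  (Real.sin (x 2) * x 4 + (Real.cos (x 2) / Tk κ₂ (x 1)) * x 5) ^ 2
    + 2 * β₁ * κ₂ ^ 2 * Tk κ₂ (x 1) ^ 2 * Real.sin (x 2) ^ 2
    + 2 * β₃ * κ₂ / (Tk κ₂ (x 1) ^ 2 * Real.sin (x 2) ^ 2)

/-- Integral I₂₃. -/
def I23 (κ₂ β₂ β₃ : ℝ) (x : Pt) : ℝ :=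
  (x 5) ^ 2 + 2 * β₂ * κ₂ * Real.tan (x 2) ^ 2 + 2 * β₃ * κ₂ / Real.tan (x 2) ^ 2

/-- Integral I₁₂₃. -/
def I123 (κ₂ β₁ β₂ β₃ : ℝ) (x : Pt) : ℝ :=
  (x 4) ^ 2 + (x 5) ^ 2 / Sk κ₂ (x 1) ^ 2 + 2 * β₁ * κ₂ / Ck κ₂ (x 1) ^ 2
    + 2 * β₂ * κ₂ / (Sk κ₂ (x 1) ^ 2 * Real.cos (x 2) ^ 2)
    + 2 * β₃ * κ₂ / (Sk κ₂ (x 1) ^ 2 * Real.sin (x 2) ^ 2)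

/-- The Smorodinsky–Winternitz Hamiltonian H^SW. -/
def HSW (κ₁ κ₂ β₀ β₁ β₂ β₃ : ℝ) (x : Pt) : ℝ :=
  Tkin κ₁ κ₂ x + β₀ * Tk κ₁ (x 0) ^ 2 + (1 / Sk κ₁ (x 0) ^ 2) *
    (β₁ / Ck κ₂ (x 1) ^ 2 + β₂ / (Sk κ₂ (x 1) ^ 2 * Real.cos (x 2) ^ 2)
      + β₃ / (Sk κ₂ (x 1) ^ 2 * Real.sin (x 2) ^ 2))

/-- Integral I₀₁ of H^SW. -/
def I01 (κ₁ κ₂ β₀ β₁ : ℝ) (x : Pt) : ℝ :=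
  J01 κ₁ κ₂ x ^ 2 + 2 * β₀ * Tk κ₁ (x 0) ^ 2 * Ck κ₂ (x 1) ^ 2
    + 2 * β₁ / (Tk κ₁ (x 0) ^ 2 * Ck κ₂ (x 1) ^ 2)

/-- Integral I₀₂ of H^SW. -/
def I02 (κ₁ κ₂ β₀ β₂ : ℝ) (x : Pt) : ℝ :=
  J02 κ₁ κ₂ x ^ 2 + 2 * β₀ * κ₂ ^ 2 * Tk κ₁ (x 0) ^ 2 * Sk κ₂ (x 1) ^ 2 * Real.cos (x 2) ^ 2
    + 2 * β₂ * κ₂ / (Tk κ₁ (x 0) ^ 2 * Sk κ₂ (x 1) ^ 2 * Real.cos (x 2) ^ 2)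

/-- Integral I₀₃ of H^SW. -/
def I03 (κ₁ κ₂ β₀ β₃ : ℝ) (x : Pt) : ℝ :=
  J03 κ₁ κ₂ x ^ 2 + 2 * β₀ * κ₂ ^ 2 * Tk κ₁ (x 0) ^ 2 * Sk κ₂ (x 1) ^ 2 * Real.sin (x 2) ^ 2
    + 2 * β₃ * κ₂ / (Tk κ₁ (x 0) ^ 2 * Sk κ₂ (x 1) ^ 2 * Real.sin (x 2) ^ 2)

/-- Generalized Kepler–Coulomb Hamiltonian H^GKC₁ = T + U^GKC₁. -/
def HGKC1 (κ₁ κ₂ k β₂ β₃ : ℝ) (x : Pt) : ℝ :=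
  Tkin κ₁ κ₂ x - k / Tk κ₁ (x 0)
    + (1 / (Sk κ₁ (x 0) ^ 2 * Sk κ₂ (x 1) ^ 2)) *
        (β₂ / Real.cos (x 2) ^ 2 + β₃ / Real.sin (x 2) ^ 2)

/-- Generalized Kepler–Coulomb Hamiltonian H^GKC₂ = T + U^GKC₂. -/
def HGKC2 (κ₁ κ₂ k β₁ β₃ : ℝ) (x : Pt) : ℝ :=
  Tkin κ₁ κ₂ x - k / Tk κ₁ (x 0)
    + (1 / Sk κ₁ (x 0) ^ 2) *
        (β₁ / Ck κ₂ (x 1) ^ 2 + β₃ / (Sk κ₂ (x 1) ^ 2 * Real.sin (x 2) ^ 2))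

/-- Generalized Kepler–Coulomb Hamiltonian H^GKC₃ = T + U^GKC₃. -/
def HGKC3 (κ₁ κ₂ k β₁ β₂ : ℝ) (x : Pt) : ℝ :=
  Tkin κ₁ κ₂ x - k / Tk κ₁ (x 0)
    + (1 / Sk κ₁ (x 0) ^ 2) *
        (β₁ / Ck κ₂ (x 1) ^ 2 + β₂ / (Sk κ₂ (x 1) ^ 2 * Real.cos (x 2) ^ 2))

/-- The function L₁. -/
def L1 (κ₁ κ₂ k β₂ β₃ : ℝ) (x : Pt) : ℝ :=
  -(J02 κ₁ κ₂ x * J12 κ₂ x) - J03 κ₁ κ₂ x * J13 κ₂ x + k * κ₂ * Ck κ₂ (x 1)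
    - (2 * κ₂ * Ck κ₂ (x 1) / (Tk κ₁ (x 0) * Sk κ₂ (x 1) ^ 2)) *
        (β₂ / Real.cos (x 2) ^ 2 + β₃ / Real.sin (x 2) ^ 2)

/-- The function L₂. -/
def L2 (κ₁ κ₂ k β₁ β₃ : ℝ) (x : Pt) : ℝ :=
  J01 κ₁ κ₂ x * J12 κ₂ x - J03 κ₁ κ₂ x * J23 x + k * κ₂ * Sk κ₂ (x 1) * Real.cos (x 2)
    - (2 * κ₂ * Real.cos (x 2) / Tk κ₁ (x 0)) *
        (β₁ * Sk κ₂ (x 1) / Ck κ₂ (x 1) ^ 2 + β₃ / (Sk κ₂ (x 1) * Real.sin (x 2) ^ 2))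

/-- The function L₃. -/
def L3 (κ₁ κ₂ k β₁ β₂ : ℝ) (x : Pt) : ℝ :=
  J01 κ₁ κ₂ x * J13 κ₂ x + J02 κ₁ κ₂ x * J23 x + k * κ₂ * Sk κ₂ (x 1) * Real.sin (x 2)
    - (2 * κ₂ * Real.sin (x 2) / Tk κ₁ (x 0)) *
        (β₁ * Sk κ₂ (x 1) / Ck κ₂ (x 1) ^ 2 + β₂ / (Sk κ₂ (x 1) * Real.cos (x 2) ^ 2))

theorem Ck_sq (w x : ℝ) : Ck (w ^ 2) x = Real.cos (w * x) := by
  rw [Ck, ← (Real.hasSum_cos (w * x)).tsum_eq]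
  congr 1; ext l
  rw [neg_pow, mul_pow, ← pow_mul]; ring

theorem Sk_sq {w : ℝ} (hw : w ≠ 0) (x : ℝ) : Sk (w ^ 2) x = Real.sin (w * x) / w := by
  rw [Sk, ← (Real.hasSum_sin (w * x)).tsum_eq, ← tsum_div_const]
  congr 1; ext l
  rw [neg_pow, mul_pow, ← pow_mul, pow_succ w]; field_simp

theorem Ck_neg_sq (w x : ℝ) : Ck (-w ^ 2) x = Real.cosh (w * x) := by
  rw [Ck, ← (Real.hasSum_cosh (w * x)).tsum_eq]
  congr 1; ext l
  rw [neg_neg, mul_pow, ← pow_mul]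

theorem Sk_neg_sq {w : ℝ} (hw : w ≠ 0) (x : ℝ) : Sk (-w ^ 2) x = Real.sinh (w * x) / w := by
  rw [Sk, ← (Real.hasSum_sinh (w * x)).tsum_eq, ← tsum_div_const]
  congr 1; ext l
  rw [neg_neg, mul_pow, ← pow_mul, pow_succ w]; field_simp

theorem Ck_zero (x : ℝ) : Ck 0 x = 1 := by
  rw [Ck, tsum_eq_single 0 fun l hl => by simp [hl]]; simp

theorem Sk_zero (x : ℝ) : Sk 0 x = x := by
  rw [Sk, tsum_eq_single 0 fun l hl => by simp [hl]]; simp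

theorem exists_eq_sq_or_neg_sq (κ : ℝ) :
    κ = 0 ∨ (∃ w : ℝ, w ≠ 0 ∧ κ = w ^ 2) ∨ ∃ w : ℝ, w ≠ 0 ∧ κ = -w ^ 2 := by
  rcases lt_trichotomy κ 0 with h | h | h
  · have h' : 0 < -κ := by linarith
    exact Or.inr (Or.inr ⟨√(-κ), (Real.sqrt_pos.2 h').ne', by rw [Real.sq_sqrt h'.le, neg_neg]⟩)
  · exact Or.inl h
  · exact Or.inr (Or.inl ⟨√κ, (Real.sqrt_pos.2 h).ne', (Real.sq_sqrt h.le).symm⟩)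

theorem Ck_sq_add_Sk_sq (κ x : ℝ) : Ck κ x ^ 2 + κ * Sk κ x ^ 2 = 1 := by
  rcases exists_eq_sq_or_neg_sq κ with rfl | ⟨w, hw, rfl⟩ | ⟨w, hw, rfl⟩
  · simp [Ck_zero]
  · rw [Ck_sq, Sk_sq hw]; field_simp
    linarith [Real.sin_sq_add_cos_sq (w * x)]
  · rw [Ck_neg_sq, Sk_neg_sq hw]; field_simp
    linarith [Real.cosh_sq (w * x)]

theorem hasDerivAt_Sk (κ x : ℝ) : HasDerivAt (Sk κ) (Ck κ x) x := by
  have hm (w : ℝ) : HasDerivAt (fun y : ℝ => w * y) w x := by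
    simpa using (hasDerivAt_id x).const_mul w
  rcases exists_eq_sq_or_neg_sq κ with rfl | ⟨w, hw, rfl⟩ | ⟨w, hw, rfl⟩
  · rw [Ck_zero, funext Sk_zero]; exact hasDerivAt_id x
  · rw [Ck_sq, funext (Sk_sq hw)]
    refine ((hm w).sin.div_const w).congr_deriv ?_
    field_simp
  · rw [Ck_neg_sq, funext (Sk_neg_sq hw)]
    refine ((hm w).sinh.div_const w).congr_deriv ?_
    field_simp

theorem hasDerivAt_Ck (κ x : ℝ) : HasDerivAt (Ck κ) (-κ * Sk κ x) x := by
  have hm (w : ℝ) : HasDerivAt (fun y : ℝ => w * y) w x := by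
    simpa using (hasDerivAt_id x).const_mul w
  rcases exists_eq_sq_or_neg_sq κ with rfl | ⟨w, hw, rfl⟩ | ⟨w, hw, rfl⟩
  · rw [funext Ck_zero]; simpa using hasDerivAt_const x (1 : ℝ)
  · rw [Sk_sq hw, funext (Ck_sq w)]
    refine (hm w).cos.congr_deriv ?_
    field_simp
  · rw [Sk_neg_sq hw, funext (Ck_neg_sq w)]
    refine (hm w).cosh.congr_deriv ?_
    field_simp

@[fun_prop]
theorem differentiable_Sk (κ : ℝ) : Differentiable ℝ (Sk κ) :=
  fun x => (hasDerivAt_Sk κ x).differentiableAt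

@[fun_prop]
theorem differentiable_Ck (κ : ℝ) : Differentiable ℝ (Ck κ) :=
  fun x => (hasDerivAt_Ck κ x).differentiableAt

/-- Near the origin, but away from it, both `Sk κ` and `Ck κ` are nonzero. -/
theorem exists_Sk_ne_zero_and_Ck_ne_zero (κ : ℝ) : ∃ x, Sk κ x ≠ 0 ∧ Ck κ x ≠ 0 := by
  have hC0 : Ck κ 0 ≠ 0 := fun h => by
    have hS : Sk κ 0 = 0 := by simp [Sk]
    simpa [h, hS] using Ck_sq_add_Sk_sq κ 0
  have hS := (hasDerivAt_Sk κ 0).eventually_ne (c := 0) hC0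
  have hC := ((differentiable_Ck κ).continuous.continuousAt.eventually_ne hC0).filter_mono
    (nhdsWithin_le_nhds (s := {0}ᶜ))
  exact (hS.and hC).exists

theorem hasDerivAt_Ck_div_Sk {κ x : ℝ} (h : Sk κ x ≠ 0) :
    HasDerivAt (fun y => Ck κ y / Sk κ y) (-1 / Sk κ x ^ 2) x := by
  refine ((hasDerivAt_Ck κ x).fun_div (hasDerivAt_Sk κ x) h).congr_deriv ?_
  rw [← Ck_sq_add_Sk_sq κ x]; ring

theorem isOpen_D (κ₁ κ₂ : ℝ) : IsOpen (D κ₁ κ₂) := by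
  have h {f : Pt → ℝ} (hf : Continuous f) : IsOpen {x | f x ≠ 0} :=
    isOpen_ne_fun hf continuous_const
  have hS (κ : ℝ) := (differentiable_Sk κ).continuous
  have hC (κ : ℝ) := (differentiable_Ck κ).continuous
  exact (h (f := fun x => Sk κ₁ (x 0)) ((hS κ₁).comp (continuous_apply 0))).inter <|
    (h (f := fun x => Ck κ₁ (x 0)) ((hC κ₁).comp (continuous_apply 0))).inter <|
    (h (f := fun x => Sk κ₂ (x 1)) ((hS κ₂).comp (continuous_apply 1))).inter <|
    (h (f := fun x => Ck κ₂ (x 1)) ((hC κ₂).comp (continuous_apply 1))).inter <|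
    (h (f := fun x => Real.cos (x 2)) (by fun_prop)).inter
      (h (f := fun x => Real.sin (x 2)) (by fun_prop))

theorem grad_congr_of_eqOn {s : Set Pt} (hs : IsOpen s) {f g : Pt → ℝ} (h : Set.EqOn f g s)
    {x : Pt} (hx : x ∈ s) : grad f x = grad g x := by
  funext i
  simp only [grad, pd, (Filter.eventuallyEq_of_mem (hs.mem_nhds hx) h).fderiv_eq]

/-- A partial derivative is the derivative along the corresponding coordinate line. -/
theorem grad_eq_of_hasDerivAt {f : Pt → ℝ} {x : Pt} {i : Fin 6} {d : ℝ}
    (hf : DifferentiableAt ℝ f x)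
    (hd : HasDerivAt (fun t => f (Function.update x i t)) d (x i)) : grad f x i = d := by
  have hx : Function.update x i (x i) = x := Function.update_eq_self i x
  have h := (hx.symm ▸ hf.hasFDerivAt : HasFDerivAt f (fderiv ℝ f x)
    (Function.update x i (x i))).comp_hasDerivAt (x i) (hasDerivAt_update x i (x i))
  exact h.unique hd

theorem grad_eq_zero_of_update {f : Pt → ℝ} {x : Pt} {i : Fin 6} (hf : DifferentiableAt ℝ f x)
    (h : ∀ t, f (Function.update x i t) = f x) : grad f x i = 0 :=
  grad_eq_of_hasDerivAt hf (by simpa only [h] using hasDerivAt_const (x i) (f x))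

/-- Block criterion: the last two vectors are separated by coordinates `0, 3`, on which the first
three vanish, and the first three by coordinates `2, 4, 5`. -/
theorem linearIndependent_of_blocks {a b c d e : Fin 6 → ℝ}
    (ha0 : a 0 = 0) (ha3 : a 3 = 0) (hb0 : b 0 = 0) (hb3 : b 3 = 0) (hc0 : c 0 = 0)
    (hc3 : c 3 = 0) (hb4 : b 4 = 0) (hde : d 0 * e 3 - d 3 * e 0 ≠ 0)
    (hdet : a 2 * (-(b 5 * c 4)) - b 2 * (a 4 * c 5 - a 5 * c 4) + c 2 * (a 4 * b 5) ≠ 0) :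
    LinearIndependent ℝ ![a, b, c, d, e] := by
  rw [Fintype.linearIndependent_iff]
  intro g hg
  have hsum (i : Fin 6) :
      g 0 * a i + g 1 * b i + g 2 * c i + g 3 * d i + g 4 * e i = 0 := by
    simpa [Fin.sum_univ_five] using congr_fun hg i
  have h0 := hsum 0
  have h3 := hsum 3
  rw [ha0, hb0, hc0] at h0
  rw [ha3, hb3, hc3] at h3
  have hg3 : g 3 = 0 := (mul_eq_zero.1 (show g 3 * (d 0 * e 3 - d 3 * e 0) = 0 by
    linear_combination e 3 * h0 - e 0 * h3)).resolve_right hde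
  have hg4 : g 4 = 0 := (mul_eq_zero.1 (show g 4 * (d 0 * e 3 - d 3 * e 0) = 0 by
    linear_combination d 0 * h3 - d 3 * h0)).resolve_right hde
  have h2 := hsum 2
  have h4 := hsum 4
  have h5 := hsum 5
  rw [hg3, hg4] at h2 h4 h5
  rw [hb4] at h4
  have hg0 : g 0 = 0 := (mul_eq_zero.1 (show g 0 *
      (a 2 * (-(b 5 * c 4)) - b 2 * (a 4 * c 5 - a 5 * c 4) + c 2 * (a 4 * b 5)) = 0 by
    linear_combination -(b 5 * c 4) * h2 - (b 2 * c 5 - b 5 * c 2) * h4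
      + b 2 * c 4 * h5)).resolve_right hdet
  have hg1 : g 1 = 0 := (mul_eq_zero.1 (show g 1 *
      (a 2 * (-(b 5 * c 4)) - b 2 * (a 4 * c 5 - a 5 * c 4) + c 2 * (a 4 * b 5)) = 0 by
    linear_combination -(a 4 * c 5 - a 5 * c 4) * h2 + (a 2 * c 5 - a 5 * c 2) * h4
      - (a 2 * c 4 - a 4 * c 2) * h5)).resolve_right hdet
  have hg2 : g 2 = 0 := (mul_eq_zero.1 (show g 2 *
      (a 2 * (-(b 5 * c 4)) - b 2 * (a 4 * c 5 - a 5 * c 4) + c 2 * (a 4 * b 5)) = 0 by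
    linear_combination a 4 * b 5 * h2 - (a 2 * b 5 - a 5 * b 2) * h4
      - a 4 * b 2 * h5)).resolve_right hdet
  intro i
  fin_cases i <;> assumption

theorem differentiableAt_I12 (κ₁ : ℝ) {κ₂ : ℝ} (β₁ β₂ : ℝ) {x : Pt} (hx : x ∈ D κ₁ κ₂) :
    DifferentiableAt ℝ (I12 κ₂ β₁ β₂) x := by
  obtain ⟨-, -, hS, hC, hc, hs⟩ := hx
  unfold I12 Tk
  fun_prop (disch := simp [hS, hC, hc])

theorem differentiableAt_I23 (κ₁ : ℝ) {κ₂ : ℝ} (β₂ β₃ : ℝ) {x : Pt} (hx : x ∈ D κ₁ κ₂) :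
    DifferentiableAt ℝ (I23 κ₂ β₂ β₃) x := by
  obtain ⟨-, -, -, -, hc, hs⟩ := hx
  unfold I23
  simp only [Real.tan_eq_sin_div_cos]
  fun_prop (disch := simp [hc, hs])

theorem differentiableAt_I123 (κ₁ : ℝ) {κ₂ : ℝ} (β₁ β₂ β₃ : ℝ) {x : Pt} (hx : x ∈ D κ₁ κ₂) :
    DifferentiableAt ℝ (I123 κ₂ β₁ β₂ β₃) x := by
  obtain ⟨-, -, hS, hC, hc, hs⟩ := hx
  unfold I123
  fun_prop (disch := simp [hS, hC, hc, hs])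

/-- The Hamiltonian in reduced form: radial motion with angular part governed by `I123`. -/
def radialHamiltonian (κ₁ κ₂ k β₁ β₂ β₃ : ℝ) (x : Pt) : ℝ :=
  x 3 ^ 2 / 2 + I123 κ₂ β₁ β₂ β₃ x / (2 * κ₂ * Sk κ₁ (x 0) ^ 2) - k * (Ck κ₁ (x 0) / Sk κ₁ (x 0))

/-- The common form of the Laplace–Runge–Lenz type functions. -/
def radialLenz (κ₁ κ₂ k β₁ β₂ β₃ : ℝ) (ν μ : Pt → ℝ) (x : Pt) : ℝ :=
  x 3 * μ x + ν x * (k * κ₂ - I123 κ₂ β₁ β₂ β₃ x * (Ck κ₁ (x 0) / Sk κ₁ (x 0)))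

/-- The function depends on neither the radial coordinate nor the radial momentum. -/
def IsAngular (f : Pt → ℝ) : Prop :=
  ∀ x t, f (Function.update x 0 t) = f x ∧ f (Function.update x 3 t) = f x

theorem isAngular_I12 (κ₂ β₁ β₂ : ℝ) : IsAngular (I12 κ₂ β₁ β₂) :=
  fun x t => by simp [I12]

theorem isAngular_I23 (κ₂ β₂ β₃ : ℝ) : IsAngular (I23 κ₂ β₂ β₃) :=
  fun x t => by simp [I23]

theorem isAngular_I123 (κ₂ β₁ β₂ β₃ : ℝ) : IsAngular (I123 κ₂ β₁ β₂ β₃) :=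
  fun x t => by simp [I123]

section Radial

variable {κ₁ κ₂ k β₁ β₂ β₃ : ℝ} {ν μ : Pt → ℝ} {x : Pt}

theorem differentiableAt_radialHamiltonian (hκ₂ : κ₂ ≠ 0) (hx : x ∈ D κ₁ κ₂) :
    DifferentiableAt ℝ (radialHamiltonian κ₁ κ₂ k β₁ β₂ β₃) x := by
  have hI := differentiableAt_I123 κ₁ β₁ β₂ β₃ hx
  have hS := hx.1
  unfold radialHamiltonian
  fun_prop (disch := simp [hS, hκ₂])

theorem differentiableAt_radialLenz (hx : x ∈ D κ₁ κ₂) (hν : DifferentiableAt ℝ ν x)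
    (hμ : DifferentiableAt ℝ μ x) :
    DifferentiableAt ℝ (radialLenz κ₁ κ₂ k β₁ β₂ β₃ ν μ) x := by
  have hI := differentiableAt_I123 κ₁ β₁ β₂ β₃ hx
  have hS := hx.1
  unfold radialLenz
  fun_prop (disch := simp [hS])

theorem grad_radialHamiltonian_three (hκ₂ : κ₂ ≠ 0) (hx : x ∈ D κ₁ κ₂) :
    grad (radialHamiltonian κ₁ κ₂ k β₁ β₂ β₃) x 3 = x 3 := by
  apply grad_eq_of_hasDerivAt (differentiableAt_radialHamiltonian hκ₂ hx)
  simp only [radialHamiltonian, (isAngular_I123 κ₂ β₁ β₂ β₃ x _).2]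
  simp only [ne_eq, Function.update_self, Fin.reduceEq, not_false_eq_true, Function.update_of_ne]
  refine ((((hasDerivAt_id (x 3)).fun_pow 2).div_const 2).add_const _ |>.sub_const _).congr_deriv ?_
  simp

theorem grad_radialHamiltonian_zero (hκ₂ : κ₂ ≠ 0) (hx : x ∈ D κ₁ κ₂) :
    grad (radialHamiltonian κ₁ κ₂ k β₁ β₂ β₃) x 0 =
      (k - I123 κ₂ β₁ β₂ β₃ x * Ck κ₁ (x 0) / (κ₂ * Sk κ₁ (x 0))) / Sk κ₁ (x 0) ^ 2 := by
  have hS := hx.1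
  apply grad_eq_of_hasDerivAt (differentiableAt_radialHamiltonian hκ₂ hx)
  simp only [radialHamiltonian, (isAngular_I123 κ₂ β₁ β₂ β₃ x _).1]
  simp only [ne_eq, Function.update_self, Fin.reduceEq, not_false_eq_true, Function.update_of_ne]
  refine (((hasDerivAt_const (x 0) _).fun_div
    (((hasDerivAt_Sk κ₁ (x 0)).fun_pow 2).const_mul (2 * κ₂)) (by simp [hκ₂, hS])).const_add _
    |>.fun_sub ((hasDerivAt_Ck_div_Sk hS).const_mul k)).congr_deriv ?_
  field_simp
  ring

theorem grad_radialLenz_three (hx : x ∈ D κ₁ κ₂) (hν : DifferentiableAt ℝ ν x)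
    (hμ : DifferentiableAt ℝ μ x) (hν' : IsAngular ν) (hμ' : IsAngular μ) :
    grad (radialLenz κ₁ κ₂ k β₁ β₂ β₃ ν μ) x 3 = μ x := by
  apply grad_eq_of_hasDerivAt (differentiableAt_radialLenz hx hν hμ)
  simp only [radialLenz, (isAngular_I123 κ₂ β₁ β₂ β₃ x _).2, (hν' x _).2, (hμ' x _).2]
  simp only [ne_eq, Function.update_self, Fin.reduceEq, not_false_eq_true, Function.update_of_ne]
  refine (((hasDerivAt_id (x 3)).mul_const (μ x)).add_const _).congr_deriv ?_
  simp

theorem grad_radialLenz_zero (hx : x ∈ D κ₁ κ₂) (hν : DifferentiableAt ℝ ν x)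
    (hμ : DifferentiableAt ℝ μ x) (hν' : IsAngular ν) (hμ' : IsAngular μ) :
    grad (radialLenz κ₁ κ₂ k β₁ β₂ β₃ ν μ) x 0 =
      ν x * I123 κ₂ β₁ β₂ β₃ x / Sk κ₁ (x 0) ^ 2 := by
  apply grad_eq_of_hasDerivAt (differentiableAt_radialLenz hx hν hμ)
  simp only [radialLenz, (isAngular_I123 κ₂ β₁ β₂ β₃ x _).1, (hν' x _).1, (hμ' x _).1]
  simp only [ne_eq, Function.update_self, Fin.reduceEq, not_false_eq_true, Function.update_of_ne]
  refine (((((hasDerivAt_Ck_div_Sk hx.1).const_mul _).const_sub _).const_mul _).const_add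
    _).congr_deriv ?_
  ring

end Radial

section Angular

variable {κ₁ κ₂ β₁ β₂ β₃ : ℝ} {x : Pt}

theorem grad_I12_four (hx : x ∈ D κ₁ κ₂) :
    grad (I12 κ₂ β₁ β₂) x 4 = 2 * J12 κ₂ x * Real.cos (x 2) := by
  apply grad_eq_of_hasDerivAt (differentiableAt_I12 κ₁ β₁ β₂ hx)
  simp only [I12, J12, ne_eq, Function.update_self, Fin.reduceEq, not_false_eq_true,
    Function.update_of_ne]
  refine ((((((hasDerivAt_id (x 4)).const_mul _).sub_const _).fun_pow 2).add_const _).add_const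
    _).congr_deriv ?_
  simp

theorem grad_I12_five (hx : x ∈ D κ₁ κ₂) :
    grad (I12 κ₂ β₁ β₂) x 5 = -(2 * J12 κ₂ x * (Real.sin (x 2) / Tk κ₂ (x 1))) := by
  apply grad_eq_of_hasDerivAt (differentiableAt_I12 κ₁ β₁ β₂ hx)
  simp only [I12, J12, ne_eq, Function.update_self, Fin.reduceEq, not_false_eq_true,
    Function.update_of_ne]
  refine ((((((hasDerivAt_id (x 5)).const_mul _).const_sub _).fun_pow 2).add_const _).add_const
    _).congr_deriv ?_
  simp

theorem grad_I23_five (hx : x ∈ D κ₁ κ₂) : grad (I23 κ₂ β₂ β₃) x 5 = 2 * x 5 := by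
  apply grad_eq_of_hasDerivAt (differentiableAt_I23 κ₁ β₂ β₃ hx)
  simp only [I23, ne_eq, Function.update_self, Fin.reduceEq, not_false_eq_true,
    Function.update_of_ne]
  refine ((((hasDerivAt_id (x 5)).fun_pow 2).add_const _).add_const _).congr_deriv ?_
  simp

theorem grad_I123_four (hx : x ∈ D κ₁ κ₂) : grad (I123 κ₂ β₁ β₂ β₃) x 4 = 2 * x 4 := by
  apply grad_eq_of_hasDerivAt (differentiableAt_I123 κ₁ β₁ β₂ β₃ hx)
  simp only [I123, ne_eq, Function.update_self, Fin.reduceEq, not_false_eq_true,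
    Function.update_of_ne]
  refine ((((((hasDerivAt_id (x 4)).fun_pow 2).add_const _).add_const _).add_const _).add_const
    _).congr_deriv ?_
  simp

theorem grad_I123_five (hx : x ∈ D κ₁ κ₂) :
    grad (I123 κ₂ β₁ β₂ β₃) x 5 = 2 * x 5 / Sk κ₂ (x 1) ^ 2 := by
  apply grad_eq_of_hasDerivAt (differentiableAt_I123 κ₁ β₁ β₂ β₃ hx)
  simp only [I123, ne_eq, Function.update_self, Fin.reduceEq, not_false_eq_true,
    Function.update_of_ne]
  refine (((((((hasDerivAt_id (x 5)).fun_pow 2).div_const _).const_add _).add_const _).add_const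
    _).add_const _).congr_deriv ?_
  simp

/-- The `φ`-derivative of `I12` is, up to the contribution of the potential, `-2 J12 J13`. -/
theorem exists_grad_I12_two (β₁ β₂ : ℝ) {θ φ : ℝ} (hS : Sk κ₂ θ ≠ 0) (hC : Ck κ₂ θ ≠ 0)
    (hc : Real.cos φ ≠ 0) :
    ∃ b, ∀ x ∈ D κ₁ κ₂, x 1 = θ → x 2 = φ →
      grad (I12 κ₂ β₁ β₂) x 2 = -(2 * J12 κ₂ x * J13 κ₂ x) + b := by
  obtain ⟨b, hB⟩ : ∃ b, HasDerivAt (fun t => 2 * β₁ * κ₂ ^ 2 * Tk κ₂ θ ^ 2 * Real.cos t ^ 2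
      + 2 * β₂ * κ₂ / (Tk κ₂ θ ^ 2 * Real.cos t ^ 2)) b φ := by
    refine ⟨_, DifferentiableAt.hasDerivAt ?_⟩
    have hT : Tk κ₂ θ ≠ 0 := div_ne_zero hS hC
    fun_prop (disch := simp [hT, hc])
  refine ⟨b, fun x hx h1 h2 => grad_eq_of_hasDerivAt (differentiableAt_I12 κ₁ β₁ β₂ hx) ?_⟩
  subst h1 h2
  simp only [I12, J12, J13, ne_eq, Function.update_self, Fin.reduceEq, not_false_eq_true,
    Function.update_of_ne, add_assoc]
  refine ((((((Real.hasDerivAt_cos (x 2)).mul_const (x 4)).fun_sub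
    (((Real.hasDerivAt_sin (x 2)).div_const (Tk κ₂ (x 1))).mul_const (x 5))).fun_pow 2).fun_add
    hB)).congr_deriv ?_
  congr 1
  push_cast
  ring

theorem exists_grad_I23_two (β₂ β₃ : ℝ) {φ : ℝ} (hc : Real.cos φ ≠ 0) (hs : Real.sin φ ≠ 0) :
    ∃ b, ∀ x ∈ D κ₁ κ₂, x 2 = φ → grad (I23 κ₂ β₂ β₃) x 2 = b := by
  obtain ⟨b, hB⟩ : ∃ b, HasDerivAt (fun t => 2 * β₂ * κ₂ * Real.tan t ^ 2
      + 2 * β₃ * κ₂ / Real.tan t ^ 2) b φ := by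
    refine ⟨_, DifferentiableAt.hasDerivAt ?_⟩
    simp only [Real.tan_eq_sin_div_cos]
    fun_prop (disch := simp [hc, hs])
  refine ⟨b, fun x hx h2 => grad_eq_of_hasDerivAt (differentiableAt_I23 κ₁ β₂ β₃ hx) ?_⟩
  subst h2
  simp only [I23, ne_eq, Function.update_self, Fin.reduceEq, not_false_eq_true,
    Function.update_of_ne, add_assoc]
  exact hB.const_add _

theorem exists_grad_I123_two (β₁ β₂ β₃ : ℝ) {θ φ : ℝ} (hS : Sk κ₂ θ ≠ 0)
    (hc : Real.cos φ ≠ 0) (hs : Real.sin φ ≠ 0) :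
    ∃ b, ∀ x ∈ D κ₁ κ₂, x 1 = θ → x 2 = φ → grad (I123 κ₂ β₁ β₂ β₃) x 2 = b := by
  obtain ⟨b, hB⟩ : ∃ b, HasDerivAt (fun t => 2 * β₂ * κ₂ / (Sk κ₂ θ ^ 2 * Real.cos t ^ 2)
      + 2 * β₃ * κ₂ / (Sk κ₂ θ ^ 2 * Real.sin t ^ 2)) b φ := by
    refine ⟨_, DifferentiableAt.hasDerivAt ?_⟩
    fun_prop (disch := simp [hS, hc, hs])
  refine ⟨b, fun x hx h1 h2 => grad_eq_of_hasDerivAt (differentiableAt_I123 κ₁ β₁ β₂ β₃ hx) ?_⟩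
  subst h1 h2
  simp only [I123, ne_eq, Function.update_self, Fin.reduceEq, not_false_eq_true,
    Function.update_of_ne, add_assoc]
  exact ((hB.const_add _).const_add _).const_add _

end Angular

theorem exists_ne_zero_mul_sq_ne {a b : ℝ} (ha : a ≠ 0) (hb : b ≠ 0) (A B : ℝ) :
    ∃ t : ℝ, t ≠ 0 ∧ a * t ^ 2 ≠ A ∧ b * t ^ 2 ≠ B := by
  refine ⟨1 + |A / a| + |B / b|, by positivity, fun h => ?_, fun h => ?_⟩
  · have h' := (eq_div_iff ha).2 ((mul_comm _ _).trans h)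
    nlinarith [le_abs_self (A / a), abs_nonneg (A / a), abs_nonneg (B / b)]
  · have h' := (eq_div_iff hb).2 ((mul_comm _ _).trans h)
    nlinarith [le_abs_self (B / b), abs_nonneg (A / a), abs_nonneg (B / b)]

/-- For suitable momenta `I123` is nonzero and so is the minor of the gradients of
`I12, I23, I123` in the directions `φ, p_θ, p_φ`, on `φ = π / 4` and any fixed `θ`. -/
theorem exists_angular_momenta (κ₁ β₁ β₂ β₃ : ℝ) {κ₂ θ : ℝ} (hS : Sk κ₂ θ ≠ 0) (hC : Ck κ₂ θ ≠ 0) :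
    ∃ p q : ℝ, ∀ x ∈ D κ₁ κ₂, x 1 = θ → x 2 = Real.pi / 4 → x 4 = p → x 5 = q →
      I123 κ₂ β₁ β₂ β₃ x ≠ 0 ∧
      grad (I12 κ₂ β₁ β₂) x 2 * (-(grad (I23 κ₂ β₂ β₃) x 5 * grad (I123 κ₂ β₁ β₂ β₃) x 4))
        - grad (I23 κ₂ β₂ β₃) x 2 *
          (grad (I12 κ₂ β₁ β₂) x 4 * grad (I123 κ₂ β₁ β₂ β₃) x 5
            - grad (I12 κ₂ β₁ β₂) x 5 * grad (I123 κ₂ β₁ β₂ β₃) x 4)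
        + grad (I123 κ₂ β₁ β₂ β₃) x 2 * (grad (I12 κ₂ β₁ β₂) x 4 * grad (I23 κ₂ β₂ β₃) x 5)
        ≠ 0 := by
  have hc : Real.cos (Real.pi / 4) ≠ 0 := by simp
  have hs : Real.sin (Real.pi / 4) ≠ 0 := by simp
  obtain ⟨b₁, h₁⟩ := exists_grad_I12_two (κ₁ := κ₁) β₁ β₂ hS hC hc
  obtain ⟨b₂, h₂⟩ := exists_grad_I23_two (κ₁ := κ₁) (κ₂ := κ₂) β₂ β₃ hc hs
  obtain ⟨b₃, h₃⟩ := exists_grad_I123_two (κ₁ := κ₁) β₁ β₂ β₃ hS hc hs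
  have hT : Tk κ₂ θ ≠ 0 := div_ne_zero hS hC
  obtain ⟨τ, hτ⟩ : ∃ τ, τ = 1 / Tk κ₂ θ := ⟨_, rfl⟩
  have hτ0 : τ ≠ 0 := by simp [hτ, hT]
  obtain ⟨t, ht, htA, htB⟩ := exists_ne_zero_mul_sq_ne
    (a := 24 * τ ^ 2) (b := (2 * τ) ^ 2 + 1 / Sk κ₂ θ ^ 2) (by simp [hτ0]) (by positivity)
    (8 * b₁ + 2 * (b₂ / Sk κ₂ θ ^ 2 - b₃) + 4 * τ ^ 2 * b₂)
    (-(2 * β₁ * κ₂ / Ck κ₂ θ ^ 2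
    + 2 * β₂ * κ₂ / (Sk κ₂ θ ^ 2 * Real.cos (Real.pi / 4) ^ 2)
    + 2 * β₃ * κ₂ / (Sk κ₂ θ ^ 2 * Real.sin (Real.pi / 4) ^ 2)))
  refine ⟨2 * τ * t, t, fun x hx hx1 hx2 hx4 hx5 => ⟨fun h => htB ?_, ?_⟩⟩
  · rw [I123, hx1, hx2, hx4, hx5] at h
    linear_combination h
  · have hr : (√2 / 2) ^ 2 = (1 / 2 : ℝ) := by
      rw [div_pow, Real.sq_sqrt zero_le_two]; norm_num
    rw [h₁ x hx hx1 hx2, h₂ x hx hx2, h₃ x hx hx1 hx2, grad_I12_four hx, grad_I12_five hx,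
      grad_I23_five hx, grad_I123_four hx, grad_I123_five hx, J12, J13, hx1, hx2, hx4, hx5,
      Real.cos_pi_div_four, Real.sin_pi_div_four, div_eq_mul_one_div _ (Tk κ₂ θ), ← hτ]
    generalize √2 / 2 = c at hr
    refine ne_of_eq_of_ne ?_ (mul_ne_zero (mul_ne_zero (pow_ne_zero 2 ht) hτ0)
      (sub_ne_zero.2 htA))
    linear_combination
      t ^ 2 * τ * (48 * τ ^ 2 * t ^ 2 - 4 * b₂ / Sk κ₂ θ ^ 2 + 4 * b₃ - 8 * τ ^ 2 * b₂) * hr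

theorem exists_linearIndependent_grad {κ₁ κ₂ k β₁ β₂ β₃ : ℝ} (hκ₂ : κ₂ ≠ 0) {ν μ : Pt → ℝ}
    (hν : ∀ x ∈ D κ₁ κ₂, DifferentiableAt ℝ ν x) (hμ : ∀ x ∈ D κ₁ κ₂, DifferentiableAt ℝ μ x)
    (hν' : IsAngular ν) (hμ' : IsAngular μ) (hν0 : ∀ x ∈ D κ₁ κ₂, ν x ≠ 0) :
    ∃ x ∈ D κ₁ κ₂, LinearIndependent ℝ
      ![grad (I12 κ₂ β₁ β₂) x, grad (I23 κ₂ β₂ β₃) x, grad (I123 κ₂ β₁ β₂ β₃) x,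
        grad (radialHamiltonian κ₁ κ₂ k β₁ β₂ β₃) x,
        grad (radialLenz κ₁ κ₂ k β₁ β₂ β₃ ν μ) x] := by
  obtain ⟨r, hSr, hCr⟩ := exists_Sk_ne_zero_and_Ck_ne_zero κ₁
  obtain ⟨θ, hSθ, hCθ⟩ := exists_Sk_ne_zero_and_Ck_ne_zero κ₂
  obtain ⟨p, q, hpq⟩ := exists_angular_momenta κ₁ β₁ β₂ β₃ hSθ hCθ
  have hD (s : ℝ) : ![r, θ, Real.pi / 4, s, p, q] ∈ D κ₁ κ₂ :=
    ⟨hSr, hCr, hSθ, hCθ, by simp, by simp⟩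
  set y : Pt := ![r, θ, Real.pi / 4, 0, p, q] with hy
  have hI := (hpq y (hD 0) rfl rfl rfl rfl).1
  have hνy := hν0 y (hD 0)
  set s : ℝ := ((k - I123 κ₂ β₁ β₂ β₃ y * Ck κ₁ r / (κ₂ * Sk κ₁ r)) * μ y - 1) /
    (ν y * I123 κ₂ β₁ β₂ β₃ y) with hs
  have hxy : Function.update y 3 s = ![r, θ, Real.pi / 4, s, p, q] := by
    ext i; fin_cases i <;> simp [hy]
  refine ⟨_, hxy ▸ hD s, ?_⟩
  set x := Function.update y 3 s
  have hx : x ∈ D κ₁ κ₂ := hxy ▸ hD s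
  have hx3 : x 3 = s := by simp [x]
  have hx0 : x 0 = r := by simp [x, hy]
  have hνx := hν x hx
  have hμx := hμ x hx
  have h12 := differentiableAt_I12 κ₁ β₁ β₂ hx
  have h23 := differentiableAt_I23 κ₁ β₂ β₃ hx
  have h123 := differentiableAt_I123 κ₁ β₁ β₂ β₃ hx
  refine linearIndependent_of_blocks
    (grad_eq_zero_of_update h12 fun t => (isAngular_I12 _ _ _ x t).1)
    (grad_eq_zero_of_update h12 fun t => (isAngular_I12 _ _ _ x t).2)
    (grad_eq_zero_of_update h23 fun t => (isAngular_I23 _ _ _ x t).1)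
    (grad_eq_zero_of_update h23 fun t => (isAngular_I23 _ _ _ x t).2)
    (grad_eq_zero_of_update h123 fun t => (isAngular_I123 _ _ _ _ x t).1)
    (grad_eq_zero_of_update h123 fun t => (isAngular_I123 _ _ _ _ x t).2)
    (grad_eq_zero_of_update h23 fun t => by simp [I23]) ?_
    (hpq x hx (by simp [x, hy]) (by simp [x, hy]) (by simp [x, hy]) (by simp [x, hy])).2
  rw [grad_radialHamiltonian_zero hκ₂ hx, grad_radialHamiltonian_three hκ₂ hx,
    grad_radialLenz_zero hx hνx hμx hν' hμ', grad_radialLenz_three hx hνx hμx hν' hμ',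
    (hν' y s).2, (hμ' y s).2, (isAngular_I123 κ₂ β₁ β₂ β₃ y s).2, hx3, hx0]
  have hs' : s * (ν y * I123 κ₂ β₁ β₂ β₃ y) =
      (k - I123 κ₂ β₁ β₂ β₃ y * Ck κ₁ r / (κ₂ * Sk κ₁ r)) * μ y - 1 :=
    div_mul_cancel₀ _ (mul_ne_zero hνy hI)
  refine ne_of_eq_of_ne (b := 1 / Sk κ₁ r ^ 2) ?_ (by simp [hSr])
  rw [mul_div_assoc', hs']
  ring

theorem eqOn_HGKC1 (κ₁ k β₂ β₃ : ℝ) {κ₂ : ℝ} (hκ₂ : κ₂ ≠ 0) :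
    Set.EqOn (HGKC1 κ₁ κ₂ k β₂ β₃) (radialHamiltonian κ₁ κ₂ k 0 β₂ β₃) (D κ₁ κ₂) := by
  rintro x ⟨hSr, hCr, hS, hC, hc, hs⟩
  simp only [HGKC1, Tkin, radialHamiltonian, I123, Tk]
  field_simp
  ring

theorem eqOn_HGKC2 (κ₁ k β₁ β₃ : ℝ) {κ₂ : ℝ} (hκ₂ : κ₂ ≠ 0) :
    Set.EqOn (HGKC2 κ₁ κ₂ k β₁ β₃) (radialHamiltonian κ₁ κ₂ k β₁ 0 β₃) (D κ₁ κ₂) := by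
  rintro x ⟨hSr, hCr, hS, hC, hc, hs⟩
  simp only [HGKC2, Tkin, radialHamiltonian, I123, Tk]
  field_simp
  ring

theorem eqOn_HGKC3 (κ₁ k β₁ β₂ : ℝ) {κ₂ : ℝ} (hκ₂ : κ₂ ≠ 0) :
    Set.EqOn (HGKC3 κ₁ κ₂ k β₁ β₂) (radialHamiltonian κ₁ κ₂ k β₁ β₂ 0) (D κ₁ κ₂) := by
  rintro x ⟨hSr, hCr, hS, hC, hc, hs⟩
  simp only [HGKC3, Tkin, radialHamiltonian, I123, Tk]
  field_simp
  ring

/-- The ambient Cartesian coordinates of the direction `(θ, φ)`. -/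
def direction (κ₂ : ℝ) (x : Pt) : Fin 3 → ℝ :=
  ![Ck κ₂ (x 1), Sk κ₂ (x 1) * Real.cos (x 2), Sk κ₂ (x 1) * Real.sin (x 2)]

/-- The velocities conjugate to `direction` under the angular kinetic energy. -/
def directionVelocity (κ₂ : ℝ) (x : Pt) : Fin 3 → ℝ :=
  ![-κ₂ * Sk κ₂ (x 1) * x 4,
    Ck κ₂ (x 1) * Real.cos (x 2) * x 4 - Real.sin (x 2) / Sk κ₂ (x 1) * x 5,
    Ck κ₂ (x 1) * Real.sin (x 2) * x 4 + Real.cos (x 2) / Sk κ₂ (x 1) * x 5]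

theorem eqOn_L1 (κ₁ κ₂ k β₂ β₃ : ℝ) :
    Set.EqOn (L1 κ₁ κ₂ k β₂ β₃) (radialLenz κ₁ κ₂ k 0 β₂ β₃ (direction κ₂ · 0)
      (directionVelocity κ₂ · 0)) (D κ₁ κ₂) := by
  rintro x ⟨hSr, hCr, hS, hC, hc, hs⟩
  simp only [L1, radialLenz, direction, directionVelocity, I123, J02, J03, J12, J13, Tk,
    Matrix.cons_val]
  have h := Real.sin_sq_add_cos_sq (x 2)
  field_simp
  linear_combination -(Ck κ₂ (x 1) * Real.cos (x 2) ^ 2 * Real.sin (x 2) ^ 2) *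
    (Sk κ₂ (x 1) ^ 3 * κ₂ * x 3 * Sk κ₁ (x 0) * x 4 + Ck κ₂ (x 1) * Ck κ₁ (x 0) *
      (Sk κ₂ (x 1) ^ 2 * x 4 ^ 2 + x 5 ^ 2)) * h

theorem eqOn_L2 (κ₁ κ₂ k β₁ β₃ : ℝ) :
    Set.EqOn (L2 κ₁ κ₂ k β₁ β₃) (radialLenz κ₁ κ₂ k β₁ 0 β₃ (direction κ₂ · 1)
      (directionVelocity κ₂ · 1)) (D κ₁ κ₂) := by
  rintro x ⟨hSr, hCr, hS, hC, hc, hs⟩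
  simp only [L2, radialLenz, direction, directionVelocity, I123, J01, J03, J12, J23, Tk,
    Matrix.cons_val]
  have h' := Ck_sq_add_Sk_sq κ₂ (x 1)
  field_simp
  linear_combination (-(Real.cos (x 2) * Real.sin (x 2) ^ 3 * Ck κ₂ (x 1) ^ 2 * x 3 * Sk κ₁ (x 0) * x 5)) * h'

theorem eqOn_L3 (κ₁ κ₂ k β₁ β₂ : ℝ) :
    Set.EqOn (L3 κ₁ κ₂ k β₁ β₂) (radialLenz κ₁ κ₂ k β₁ β₂ 0 (direction κ₂ · 2)
      (directionVelocity κ₂ · 2)) (D κ₁ κ₂) := by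
  rintro x ⟨hSr, hCr, hS, hC, hc, hs⟩
  simp only [L3, radialLenz, direction, directionVelocity, I123, J01, J02, J13, J23, Tk,
    Matrix.cons_val]
  have h' := Ck_sq_add_Sk_sq κ₂ (x 1)
  field_simp
  linear_combination (Real.sin (x 2) * Real.cos (x 2) ^ 3 * Ck κ₂ (x 1) ^ 2 * x 3 * Sk κ₁ (x 0) * x 5) * h'

theorem exists_linearIndependent_grad_of_eqOn {κ₁ κ₂ k β₁ β₂ β₃ : ℝ} (hκ₂ : κ₂ ≠ 0)
    {H L : Pt → ℝ} (i : Fin 3)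
    (hH : Set.EqOn H (radialHamiltonian κ₁ κ₂ k β₁ β₂ β₃) (D κ₁ κ₂))
    (hL : Set.EqOn L (radialLenz κ₁ κ₂ k β₁ β₂ β₃ (direction κ₂ · i) (directionVelocity κ₂ · i))
      (D κ₁ κ₂)) :
    ∃ x ∈ D κ₁ κ₂, LinearIndependent ℝ
      ![grad (I12 κ₂ β₁ β₂) x, grad (I23 κ₂ β₂ β₃) x, grad (I123 κ₂ β₁ β₂ β₃) x,
        grad H x, grad L x] := by
  obtain ⟨x, hx, h⟩ : ∃ x ∈ D κ₁ κ₂, LinearIndependent ℝ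
      ![grad (I12 κ₂ β₁ β₂) x, grad (I23 κ₂ β₂ β₃) x, grad (I123 κ₂ β₁ β₂ β₃) x,
        grad (radialHamiltonian κ₁ κ₂ k β₁ β₂ β₃) x,
        grad (radialLenz κ₁ κ₂ k β₁ β₂ β₃ (direction κ₂ · i) (directionVelocity κ₂ · i)) x] := by
    apply exists_linearIndependent_grad hκ₂
    · rintro x -
      fin_cases i <;> simp [direction] <;> fun_prop
    · rintro x ⟨-, -, hS, -⟩
      fin_cases i <;> simp [directionVelocity] <;> fun_prop (disch := exact hS)
    · intro x t
      simp [direction]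
    · intro x t
      simp [directionVelocity]
    · rintro x ⟨-, -, hS, hC, hc, hs⟩
      fin_cases i <;> simp [direction, hS, hC, hc, hs]
  refine ⟨x, hx, ?_⟩
  rwa [grad_congr_of_eqOn (isOpen_D κ₁ κ₂) hH hx, grad_congr_of_eqOn (isOpen_D κ₁ κ₂) hL hx]

/-- for i, j ∈ {1,2,3}, j ≠ i, with βᵢ = β_j = 0, the family
I₁₂, I₂₃, I₁₂₃, H^GKC_i together with either Lᵢ or L_j is functionally
independent on D.  All six cases (i,j) are listed, each with both choices. -/
theorem GKC_two_integral_independence (κ₁ κ₂ k β₁ β₂ β₃ : ℝ) (hκ₂ : κ₂ ≠ 0) :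
    -- i = 1, j = 2 (β₁ = β₂ = 0)
    ((∃ x ∈ D κ₁ κ₂, LinearIndependent ℝ
        ![grad (I12 κ₂ 0 0) x, grad (I23 κ₂ 0 β₃) x, grad (I123 κ₂ 0 0 β₃) x,
          grad (HGKC1 κ₁ κ₂ k 0 β₃) x, grad (L1 κ₁ κ₂ k 0 β₃) x]) ∧
     (∃ x ∈ D κ₁ κ₂, LinearIndependent ℝ
        ![grad (I12 κ₂ 0 0) x, grad (I23 κ₂ 0 β₃) x, grad (I123 κ₂ 0 0 β₃) x,
          grad (HGKC1 κ₁ κ₂ k 0 β₃) x, grad (L2 κ₁ κ₂ k 0 β₃) x])) ∧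
    -- i = 1, j = 3 (β₁ = β₃ = 0)
    ((∃ x ∈ D κ₁ κ₂, LinearIndependent ℝ
        ![grad (I12 κ₂ 0 β₂) x, grad (I23 κ₂ β₂ 0) x, grad (I123 κ₂ 0 β₂ 0) x,
          grad (HGKC1 κ₁ κ₂ k β₂ 0) x, grad (L1 κ₁ κ₂ k β₂ 0) x]) ∧
     (∃ x ∈ D κ₁ κ₂, LinearIndependent ℝ
        ![grad (I12 κ₂ 0 β₂) x, grad (I23 κ₂ β₂ 0) x, grad (I123 κ₂ 0 β₂ 0) x,
          grad (HGKC1 κ₁ κ₂ k β₂ 0) x, grad (L3 κ₁ κ₂ k 0 β₂) x])) ∧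
    -- i = 2, j = 1 (β₂ = β₁ = 0)
    ((∃ x ∈ D κ₁ κ₂, LinearIndependent ℝ
        ![grad (I12 κ₂ 0 0) x, grad (I23 κ₂ 0 β₃) x, grad (I123 κ₂ 0 0 β₃) x,
          grad (HGKC2 κ₁ κ₂ k 0 β₃) x, grad (L2 κ₁ κ₂ k 0 β₃) x]) ∧
     (∃ x ∈ D κ₁ κ₂, LinearIndependent ℝ
        ![grad (I12 κ₂ 0 0) x, grad (I23 κ₂ 0 β₃) x, grad (I123 κ₂ 0 0 β₃) x,
          grad (HGKC2 κ₁ κ₂ k 0 β₃) x, grad (L1 κ₁ κ₂ k 0 β₃) x])) ∧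
    -- i = 2, j = 3 (β₂ = β₃ = 0)
    ((∃ x ∈ D κ₁ κ₂, LinearIndependent ℝ
        ![grad (I12 κ₂ β₁ 0) x, grad (I23 κ₂ 0 0) x, grad (I123 κ₂ β₁ 0 0) x,
          grad (HGKC2 κ₁ κ₂ k β₁ 0) x, grad (L2 κ₁ κ₂ k β₁ 0) x]) ∧
     (∃ x ∈ D κ₁ κ₂, LinearIndependent ℝ
        ![grad (I12 κ₂ β₁ 0) x, grad (I23 κ₂ 0 0) x, grad (I123 κ₂ β₁ 0 0) x,
          grad (HGKC2 κ₁ κ₂ k β₁ 0) x, grad (L3 κ₁ κ₂ k β₁ 0) x])) ∧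
    -- i = 3, j = 1 (β₃ = β₁ = 0)
    ((∃ x ∈ D κ₁ κ₂, LinearIndependent ℝ
        ![grad (I12 κ₂ 0 β₂) x, grad (I23 κ₂ β₂ 0) x, grad (I123 κ₂ 0 β₂ 0) x,
          grad (HGKC3 κ₁ κ₂ k 0 β₂) x, grad (L3 κ₁ κ₂ k 0 β₂) x]) ∧
     (∃ x ∈ D κ₁ κ₂, LinearIndependent ℝ
        ![grad (I12 κ₂ 0 β₂) x, grad (I23 κ₂ β₂ 0) x, grad (I123 κ₂ 0 β₂ 0) x,
          grad (HGKC3 κ₁ κ₂ k 0 β₂) x, grad (L1 κ₁ κ₂ k β₂ 0) x])) ∧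
    -- i = 3, j = 2 (β₃ = β₂ = 0)
    ((∃ x ∈ D κ₁ κ₂, LinearIndependent ℝ
        ![grad (I12 κ₂ β₁ 0) x, grad (I23 κ₂ 0 0) x, grad (I123 κ₂ β₁ 0 0) x,
          grad (HGKC3 κ₁ κ₂ k β₁ 0) x, grad (L3 κ₁ κ₂ k β₁ 0) x]) ∧
     (∃ x ∈ D κ₁ κ₂, LinearIndependent ℝ
        ![grad (I12 κ₂ β₁ 0) x, grad (I23 κ₂ 0 0) x, grad (I123 κ₂ β₁ 0 0) x,
          grad (HGKC3 κ₁ κ₂ k β₁ 0) x, grad (L2 κ₁ κ₂ k β₁ 0) x])) := by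
  exact ⟨⟨exists_linearIndependent_grad_of_eqOn hκ₂ 0 (eqOn_HGKC1 κ₁ k 0 β₃ hκ₂)
      (eqOn_L1 κ₁ κ₂ k 0 β₃),
     exists_linearIndependent_grad_of_eqOn hκ₂ 1 (eqOn_HGKC1 κ₁ k 0 β₃ hκ₂)
      (eqOn_L2 κ₁ κ₂ k 0 β₃)⟩,
    ⟨exists_linearIndependent_grad_of_eqOn hκ₂ 0 (eqOn_HGKC1 κ₁ k β₂ 0 hκ₂)
      (eqOn_L1 κ₁ κ₂ k β₂ 0),
     exists_linearIndependent_grad_of_eqOn hκ₂ 2 (eqOn_HGKC1 κ₁ k β₂ 0 hκ₂)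
      (eqOn_L3 κ₁ κ₂ k 0 β₂)⟩,
    ⟨exists_linearIndependent_grad_of_eqOn hκ₂ 1 (eqOn_HGKC2 κ₁ k 0 β₃ hκ₂)
      (eqOn_L2 κ₁ κ₂ k 0 β₃),
     exists_linearIndependent_grad_of_eqOn hκ₂ 0 (eqOn_HGKC2 κ₁ k 0 β₃ hκ₂)
      (eqOn_L1 κ₁ κ₂ k 0 β₃)⟩,
    ⟨exists_linearIndependent_grad_of_eqOn hκ₂ 1 (eqOn_HGKC2 κ₁ k β₁ 0 hκ₂)
      (eqOn_L2 κ₁ κ₂ k β₁ 0),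
     exists_linearIndependent_grad_of_eqOn hκ₂ 2 (eqOn_HGKC2 κ₁ k β₁ 0 hκ₂)
      (eqOn_L3 κ₁ κ₂ k β₁ 0)⟩,
    ⟨exists_linearIndependent_grad_of_eqOn hκ₂ 2 (eqOn_HGKC3 κ₁ k 0 β₂ hκ₂)
      (eqOn_L3 κ₁ κ₂ k 0 β₂),
     exists_linearIndependent_grad_of_eqOn hκ₂ 0 (eqOn_HGKC3 κ₁ k 0 β₂ hκ₂)
      (eqOn_L1 κ₁ κ₂ k β₂ 0)⟩,
    ⟨exists_linearIndependent_grad_of_eqOn hκ₂ 2 (eqOn_HGKC3 κ₁ k β₁ 0 hκ₂)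
      (eqOn_L3 κ₁ κ₂ k β₁ 0),
     exists_linearIndependent_grad_of_eqOn hκ₂ 1 (eqOn_HGKC3 κ₁ k β₁ 0 hκ₂)
      (eqOn_L2 κ₁ κ₂ k β₁ 0)⟩⟩

end
end Paper
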